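/- arXiv:2502.09363 — 2 statements merged into one kernel-verified Lean document; each statement's English description precedes it below -/
import Mathlib

section
/- Let d_e > 0, d_q > 0 and γ ∈ (0,1] with d_q ≥ γ·d_e. Then the expected label accuracy given overlap satisfies f(d_q) = d_e·(2γ·d_q − 2γ²·d_e + d_q) / (d_q·(d_e + d_q)). -/
open Real

/-- The overlap between the event interval `[t - d_e, t]` and the query segment `[0, d_q]`. -/
noncomputable def overlap (d_e d_q t : ℝ) : ℝ :=
  max 0 (min (min t d_q) (min d_e (d_e + d_q - t)))

/-- The label-accuracy function: `ov t / d_q` when the annotator gives a presence label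
(overlap at least `γ * d_e`), and `1 - ov t / d_q` otherwise (absence label). -/
noncomputable def labelAcc (d_e d_q γ t : ℝ) : ℝ :=
  if γ * d_e ≤ overlap d_e d_q t then overlap d_e d_q t / d_q
  else 1 - overlap d_e d_q t / d_q

/-- A function that is affine on `(a, b)` is interval integrable, with the expected integral. -/
theorem intervalIntegrable_and_integral_of_affine_on_Ioo {f : ℝ → ℝ} {a b c k : ℝ} (hab : a ≤ b)
    (hf : ∀ t ∈ Set.Ioo a b, f t = c + k * t) :
    IntervalIntegrable f MeasureTheory.volume a b ∧
      ∫ t in a..b, f t = c * (b - a) + k * ((b ^ 2 - a ^ 2) / 2) := by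
  have hg : IntervalIntegrable (fun t : ℝ => c + k * t) MeasureTheory.volume a b :=
    Continuous.intervalIntegrable (by fun_prop) a b
  have hgf : Set.EqOn (fun t : ℝ => c + k * t) f (Set.uIoo a b) := by
    rw [Set.uIoo_of_le hab]
    exact fun t ht => (hf t ht).symm
  refine ⟨hg.congr_uIoo hgf, ?_⟩
  rw [← intervalIntegral.integral_congr_uIoo hgf,
    intervalIntegral.integral_add (by simp) (Continuous.intervalIntegrable (by fun_prop) a b),
    intervalIntegral.integral_const_mul, intervalIntegral.integral_const, integral_id]
  simp only [smul_eq_mul]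
  ring

theorem overlap_eq_of_le_min {d_e d_q t : ℝ} (h0 : 0 ≤ t) (h1 : t ≤ min d_e d_q) :
    overlap d_e d_q t = t := by
  obtain ⟨he, hq⟩ := le_min_iff.1 h1
  rw [overlap, min_eq_left hq, min_eq_left (le_min he (by linarith)), max_eq_right h0]

theorem overlap_reflect (d_e d_q t : ℝ) :
    overlap d_e d_q (d_e + d_q - t) = overlap d_e d_q t := by
  unfold overlap
  rw [sub_sub_cancel]
  congr 1
  ac_rfl

theorem overlap_eq_min {d_e d_q t : ℝ} (hde : 0 ≤ d_e) (hdq : 0 ≤ d_q)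
    (h1 : min d_e d_q ≤ t) (h2 : t ≤ max d_e d_q) : overlap d_e d_q t = min d_e d_q := by
  unfold overlap
  grind

theorem labelAcc_reflect (d_e d_q γ t : ℝ) :
    labelAcc d_e d_q γ (d_e + d_q - t) = labelAcc d_e d_q γ t := by
  simp only [labelAcc, overlap_reflect]

theorem expected_labelAcc_of_ge (d_e d_q γ : ℝ) (hde : 0 < d_e) (hdq : 0 < d_q)
    (hγ : γ ∈ Set.Ioc (0 : ℝ) 1) (h : γ * d_e ≤ d_q) :
    (1 / (d_e + d_q)) * ∫ t in (0 : ℝ)..(d_e + d_q), labelAcc d_e d_q γ t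
      = d_e * (2 * γ * d_q - 2 * γ ^ 2 * d_e + d_q) / (d_q * (d_e + d_q)) := by
  obtain ⟨hγ0, hγ1⟩ := hγ
  have hS := min_add_max d_e d_q
  have hP := min_mul_max d_e d_q
  have hle : min d_e d_q ≤ max d_e d_q := min_le_max
  have ha0 : 0 ≤ γ * d_e := by positivity
  have ham : γ * d_e ≤ min d_e d_q := le_min (by nlinarith) h
  have hmid_ov (t : ℝ) := overlap_eq_min (t := t) hde.le hdq.le
  have hlow_ov (t : ℝ) := overlap_eq_of_le_min (d_e := d_e) (d_q := d_q) (t := t)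
  set m := min d_e d_q
  set M := max d_e d_q
  set a := γ * d_e with ha
  have habsent : ∀ t, 0 < t → t < a → labelAcc d_e d_q γ t = 1 - t / d_q := fun t h0 h1 => by
    rw [labelAcc, hlow_ov t h0.le (by linarith), if_neg (by linarith)]
  have hpresent : ∀ t, a < t → t < m → labelAcc d_e d_q γ t = t / d_q := fun t h0 h1 => by
    rw [labelAcc, hlow_ov t (by linarith) h1.le, if_pos (by linarith)]
  obtain ⟨i1, e1⟩ := intervalIntegrable_and_integral_of_affine_on_Ioo (f := labelAcc d_e d_q γ)
    (c := 1) (k := -1 / d_q) ha0 fun t ht => by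
      rw [habsent t ht.1 ht.2]; ring
  obtain ⟨i2, e2⟩ := intervalIntegrable_and_integral_of_affine_on_Ioo (f := labelAcc d_e d_q γ)
    (c := 0) (k := 1 / d_q) ham fun t ht => by
      rw [hpresent t ht.1 ht.2]; ring
  obtain ⟨i3, e3⟩ := intervalIntegrable_and_integral_of_affine_on_Ioo (f := labelAcc d_e d_q γ)
    (c := m / d_q) (k := 0) hle fun t ht => by
      rw [labelAcc, hmid_ov t ht.1.le ht.2.le, if_pos ham]; ring
  obtain ⟨i4, e4⟩ := intervalIntegrable_and_integral_of_affine_on_Ioo (f := labelAcc d_e d_q γ)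
    (a := M) (b := d_e + d_q - a) (c := (d_e + d_q) / d_q) (k := -1 / d_q) (by linarith)
    fun t ht => by
      rw [← labelAcc_reflect, hpresent _ (by linarith [ht.2]) (by linarith [ht.1])]; ring
  obtain ⟨i5, e5⟩ := intervalIntegrable_and_integral_of_affine_on_Ioo (f := labelAcc d_e d_q γ)
    (a := d_e + d_q - a) (b := d_e + d_q) (c := 1 - (d_e + d_q) / d_q) (k := 1 / d_q)
    (by linarith) fun t ht => by
      rw [← labelAcc_reflect, habsent _ (by linarith [ht.2]) (by linarith [ht.1])]; ring
  have i12 := i1.trans i2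
  have i123 := i12.trans i3
  have i1234 := i123.trans i4
  have hM : M = d_e + d_q - m := by linarith
  have hm : m * (d_e + d_q - m) = d_e * d_q := hM ▸ hP
  rw [← intervalIntegral.integral_add_adjacent_intervals i1234 i5,
    ← intervalIntegral.integral_add_adjacent_intervals i123 i4,
    ← intervalIntegral.integral_add_adjacent_intervals i12 i3,
    ← intervalIntegral.integral_add_adjacent_intervals i1 i2, e1, e2, e3, e4, e5, hM, ha]
  field_simp
  linear_combination 2 * hm
end

section
/- Let d_e > 0, d_q > 0 and γ ∈ (0,1] with d_q < γ·d_e. Then the expected label accuracy given overlap satisfies f(d_q) = d_q / (d_e + d_q). -/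
open Real

theorem labelAcc_of_lt {d_e d_q γ t : ℝ} (hdq : 0 < d_q) (h : d_q < γ * d_e) :
    labelAcc d_e d_q γ t = 1 - overlap d_e d_q t / d_q := by
  have hle : overlap d_e d_q t ≤ d_q :=
    max_le hdq.le ((min_le_left _ _).trans (min_le_right _ _))
  exact if_neg (not_le.mpr (hle.trans_lt h))

theorem continuous_overlap (d_e d_q : ℝ) : Continuous (overlap d_e d_q) := by
  unfold overlap
  fun_prop

theorem integral_overlap {d_e d_q : ℝ} (hdq : 0 ≤ d_q) (h : d_q ≤ d_e) :
    ∫ t in (0 : ℝ)..(d_e + d_q), overlap d_e d_q t = d_e * d_q := by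
  have hint (a b : ℝ) : IntervalIntegrable (overlap d_e d_q) MeasureTheory.volume a b :=
    (continuous_overlap d_e d_q).intervalIntegrable a b
  have rising : ∫ t in (0 : ℝ)..d_q, overlap d_e d_q t = ∫ t in (0 : ℝ)..d_q, t := by
    refine intervalIntegral.integral_congr fun t ht => ?_
    rw [Set.uIcc_of_le hdq] at ht
    obtain ⟨h0, h1⟩ := ht
    simp only [overlap]
    rw [min_eq_left h1, min_eq_left (le_min (by linarith) (by linarith)), max_eq_right h0]
  have plateau : ∫ t in d_q..d_e, overlap d_e d_q t = ∫ _ in d_q..d_e, d_q := by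
    refine intervalIntegral.integral_congr fun t ht => ?_
    rw [Set.uIcc_of_le h] at ht
    obtain ⟨h0, h1⟩ := ht
    simp only [overlap]
    rw [min_eq_right h0, min_eq_left (le_min (by linarith) (by linarith)), max_eq_right hdq]
  have falling : ∫ t in d_e..(d_e + d_q), overlap d_e d_q t
      = ∫ t in d_e..(d_e + d_q), (d_e + d_q - t) := by
    refine intervalIntegral.integral_congr fun t ht => ?_
    rw [Set.uIcc_of_le (by linarith)] at ht
    obtain ⟨h0, h1⟩ := ht
    simp only [overlap]
    rw [min_eq_right (by linarith : d_q ≤ t), min_eq_right (by linarith : d_e + d_q - t ≤ d_e),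
      min_eq_right (by linarith), max_eq_right (by linarith)]
  rw [← intervalIntegral.integral_add_adjacent_intervals (hint 0 d_e) (hint d_e _),
    ← intervalIntegral.integral_add_adjacent_intervals (hint 0 d_q) (hint d_q d_e),
    rising, plateau, falling, intervalIntegral.integral_comp_sub_left (fun t => t)]
  simp only [integral_id, intervalIntegral.integral_const, smul_eq_mul]
  ring

theorem expected_labelAcc_of_lt (d_e d_q γ : ℝ) (hde : 0 < d_e) (hdq : 0 < d_q)
    (hγ : γ ∈ Set.Ioc (0 : ℝ) 1) (h : d_q < γ * d_e) :
    (1 / (d_e + d_q)) * ∫ t in (0 : ℝ)..(d_e + d_q), labelAcc d_e d_q γ t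
      = d_q / (d_e + d_q) := by
  have hlt : d_q < d_e := h.trans_le (mul_le_of_le_one_left hde.le hγ.2)
  simp only [labelAcc_of_lt hdq h]
  rw [intervalIntegral.integral_sub intervalIntegrable_const
      (((continuous_overlap d_e d_q).div_const d_q).intervalIntegrable _ _),
    intervalIntegral.integral_div, integral_overlap hdq.le hlt.le,
    intervalIntegral.integral_const, smul_eq_mul]
  field_simp
  ring
end
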